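/- Let V' = ℝe₋ ⊕ ℝe₊ ⊕ W be a real vector space of dimension n+2 with nondegenerate symmetric bilinear form, e₋, e₊ null with ⟨e₋,e₊⟩ = 1, W = (span{e₋,e₊})^⊥ oriented with metric volume form dM, and orient V' by the volume form dM' = −e₋♭ ∧ e₊♭ ∧ dM. Let *' denote the Hodge star on V' and * the Hodge star on W. If a (p+1)-form α on V' has components (α₋, α₀, α∓, α₊) with respect to the decomposition α = e₋♭∧α₋ + α₀ + e₋♭∧e₊♭∧α∓ + e₊♭∧α₊, then *'α has components ((−1)^p *α₋, *α∓, −*α₀, (−1)^{p+1} *α₊). -/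

import Mathlib

set_option synthInstance.maxHeartbeats 1000000
set_option maxHeartbeats 1000000

/-- The algebra of exterior forms on `V`: the exterior algebra of the dual space `V*`. -/
abbrev FormAlg (V : Type*) [AddCommGroup V] [Module ℝ V] : Type _ :=
  ExteriorAlgebra ℝ (Module.Dual ℝ V)

variable {V : Type*} [AddCommGroup V] [Module ℝ V]

/-- Interior product (contraction) `ι_v` of a vector `v` into forms. -/
noncomputable def iprod (v : V) (α : FormAlg V) : FormAlg V :=
  CliffordAlgebra.contractLeft (Q := (0 : QuadraticForm ℝ (Module.Dual ℝ V)))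
    (Module.Dual.eval ℝ V v) α

/-- The metric dual (musical `♭`) of a vector. -/
noncomputable def flat (g : LinearMap.BilinForm ℝ V) (v : V) : Module.Dual ℝ V := g v

/-- Wedge product of a covector with a form. -/
noncomputable def cwedge (f : Module.Dual ℝ V) (α : FormAlg V) : FormAlg V :=
  ExteriorAlgebra.ι ℝ (M := Module.Dual ℝ V) f * α

/-- Wedge product `v♭ ∧ α` of the metric dual of a vector with a form. -/
noncomputable def flatWedge (g : LinearMap.BilinForm ℝ V) (v : V) (α : FormAlg V) :
    FormAlg V :=
  cwedge (flat g v) α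

/-- The decomposable form `x₁♭ ∧ ⋯ ∧ x_p♭`. -/
noncomputable def flatMulti (g : LinearMap.BilinForm ℝ V) (p : ℕ) (x : Fin p → V) :
    FormAlg V :=
  ExteriorAlgebra.ιMulti ℝ p (M := Module.Dual ℝ V) (fun i => flat g (x i))

/-- Wedge product of two forms. -/
noncomputable def wedgeF (α β : FormAlg V) : FormAlg V := α * β

section ExteriorContraction

open ExteriorAlgebra

variable {M : Type*} [AddCommGroup M] [Module ℝ M]

/-- Contraction of an element of the exterior algebra by a linear functional. -/
noncomputable def contr (d : Module.Dual ℝ M) : ExteriorAlgebra ℝ M →ₗ[ℝ] ExteriorAlgebra ℝ M :=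
  CliffordAlgebra.contractLeft (Q := (0 : QuadraticForm ℝ M)) d

theorem contr_algebraMap (d : Module.Dual ℝ M) (r : ℝ) :
    contr d (algebraMap ℝ (ExteriorAlgebra ℝ M) r) = 0 :=
  CliffordAlgebra.contractLeft_algebraMap (Q := 0) d r

theorem contr_ι_mul (d : Module.Dual ℝ M) (m : M) (x : ExteriorAlgebra ℝ M) :
    contr d (ι ℝ m * x) = d m • x - ι ℝ m * contr d x :=
  CliffordAlgebra.contractLeft_ι_mul d m x

theorem ExteriorAlgebra.ι_mul_ι_comm (a b : M) : ι ℝ a * ι ℝ b = -(ι ℝ b * ι ℝ a) :=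
  eq_neg_of_add_eq_zero_left (ι_add_mul_swap a b)

theorem ExteriorAlgebra.ι_mul_ι_mul_self (a : M) (x : ExteriorAlgebra ℝ M) :
    ι ℝ a * (ι ℝ a * x) = 0 := by
  rw [← mul_assoc, ι_sq_zero, zero_mul]

theorem ExteriorAlgebra.ι_mul_left_comm (a b : M) (x : ExteriorAlgebra ℝ M) :
    ι ℝ a * (ι ℝ b * x) = -(ι ℝ b * (ι ℝ a * x)) := by
  rw [← mul_assoc, ι_mul_ι_comm, neg_mul, mul_assoc]

theorem ExteriorAlgebra.ι_mul_mem {q : ℕ} (m : M) {x : ExteriorAlgebra ℝ M} (hx : x ∈ ⋀[ℝ]^q M) :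
    ι ℝ m * x ∈ ⋀[ℝ]^(q + 1) M := by
  rw [exteriorPower, pow_succ']
  exact Submodule.mul_mem_mul (LinearMap.mem_range_self _ _) hx

theorem ExteriorAlgebra.mul_mem {k l : ℕ} {x y : ExteriorAlgebra ℝ M}
    (hx : x ∈ ⋀[ℝ]^k M) (hy : y ∈ ⋀[ℝ]^l M) : x * y ∈ ⋀[ℝ]^(k + l) M := by
  rw [exteriorPower, pow_add]
  exact Submodule.mul_mem_mul hx hy

theorem contr_eq_zero_of_mem_zero (d : Module.Dual ℝ M) {x : ExteriorAlgebra ℝ M}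
    (hx : x ∈ ⋀[ℝ]^0 M) : contr d x = 0 := by
  rw [exteriorPower, pow_zero, Submodule.mem_one] at hx
  obtain ⟨r, rfl⟩ := hx
  exact contr_algebraMap d r

theorem contr_mem (d : Module.Dual ℝ M) {q : ℕ} {x : ExteriorAlgebra ℝ M}
    (hx : x ∈ ⋀[ℝ]^(q + 1) M) : contr d x ∈ ⋀[ℝ]^q M := by
  induction q generalizing x with
  | zero =>
    rw [exteriorPower, zero_add, pow_one] at hx
    obtain ⟨m, rfl⟩ := hx
    rw [← mul_one (ι ℝ m), contr_ι_mul, ← map_one (algebraMap ℝ (ExteriorAlgebra ℝ M)),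
      contr_algebraMap, mul_zero, sub_zero, exteriorPower, pow_zero]
    exact Submodule.smul_mem _ _ (by rw [map_one]; exact Submodule.one_le.mp le_rfl)
  | succ q ih =>
    rw [exteriorPower, pow_succ'] at hx
    induction hx using Submodule.mul_induction_on' with
    | mem_mul_mem m hm y hy =>
      obtain ⟨m, rfl⟩ := hm
      rw [contr_ι_mul]
      exact Submodule.sub_mem _ (Submodule.smul_mem _ _ hy) (ι_mul_mem m (ih hy))
    | add x hx y hy h1 h2 => rw [map_add]; exact Submodule.add_mem _ h1 h2

/-- Graded commutation of a vector past an element of degree `q`. -/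
theorem ExteriorAlgebra.mul_ι_of_mem {q : ℕ} {x : ExteriorAlgebra ℝ M} (hx : x ∈ ⋀[ℝ]^q M)
    (m : M) : x * ι ℝ m = (-1 : ℝ) ^ q • (ι ℝ m * x) := by
  induction hx using Submodule.pow_induction_on_left' with
  | algebraMap r => rw [pow_zero, one_smul, Algebra.commutes]
  | add x y i hx hy h1 h2 => rw [add_mul, h1, h2, mul_add, smul_add]
  | mem_mul a ha i x hx ih =>
    obtain ⟨a, rfl⟩ := ha
    rw [mul_assoc, ih, mul_smul_comm, ι_mul_left_comm a m, pow_succ]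
    simp

/-- The projection of `M` to the kernel of `d` along `m`. -/
noncomputable def projKer (d : Module.Dual ℝ M) (m : M) : M →ₗ[ℝ] M :=
  LinearMap.id - d.smulRight m

theorem map_projKer (d : Module.Dual ℝ M) (m : M) (x : ExteriorAlgebra ℝ M) :
    ExteriorAlgebra.map (projKer d m) x = x - ι ℝ m * contr d x := by
  induction x using CliffordAlgebra.left_induction with
  | algebraMap r => simp [contr_algebraMap]
  | add x y h1 h2 => rw [map_add, h1, h2, map_add, mul_add]; abel
  | ι_mul x a ih =>
    change ExteriorAlgebra.map (projKer d m) (ι ℝ a * x) = ι ℝ a * x - ι ℝ m * contr d (ι ℝ a * x)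
    rw [map_mul, ih, map_apply_ι, contr_ι_mul]
    simp only [projKer, LinearMap.sub_apply, LinearMap.id_apply, LinearMap.smulRight_apply,
      map_sub, map_smul, sub_mul, mul_sub, smul_mul_assoc, mul_smul_comm, ι_mul_ι_mul_self]
    rw [ι_mul_left_comm a m]
    module

theorem contr_map_eq_zero (d : Module.Dual ℝ M) (f : M →ₗ[ℝ] M) (h : ∀ m, d (f m) = 0)
    (x : ExteriorAlgebra ℝ M) : contr d (ExteriorAlgebra.map f x) = 0 := by
  induction x using CliffordAlgebra.left_induction with
  | algebraMap r => simp [contr_algebraMap]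
  | add x y h1 h2 => rw [map_add, map_add, h1, h2, add_zero]
  | ι_mul x a ih =>
    change contr d (ExteriorAlgebra.map f (ι ℝ a * x)) = 0
    rw [map_mul, map_apply_ι, contr_ι_mul, ih, h, zero_smul, mul_zero, sub_zero]

/-- Contraction of a decomposable element. -/
theorem contr_ιMulti (d : Module.Dual ℝ M) {q : ℕ} (f : Fin (q + 1) → M) :
    contr d (ιMulti ℝ (q + 1) f)
      = ∑ j : Fin (q + 1), ((-1 : ℝ) ^ (j : ℕ) * d (f j)) • ιMulti ℝ q (f ∘ j.succAbove) := by
  induction q with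
  | zero =>
    rw [ιMulti_succ_apply, contr_ι_mul, ιMulti_zero_apply,
      ← map_one (algebraMap ℝ (ExteriorAlgebra ℝ M)), contr_algebraMap]
    simp
  | succ q ih =>
    rw [ιMulti_succ_apply, contr_ι_mul, ih, Fin.sum_univ_succ (n := q + 1), Finset.mul_sum,
      sub_eq_add_neg, ← Finset.sum_neg_distrib]
    congr 1
    · simp [Matrix.vecTail, Function.comp_def]
    · refine Finset.sum_congr rfl fun j _ => ?_
      rw [ιMulti_succ_apply (f ∘ j.succ.succAbove), mul_smul_comm, ← neg_smul]
      congr 1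
      · simp [Matrix.vecTail, pow_succ]
      · simp [Matrix.vecTail, Function.comp_def]

/-- Euler's identity: `∑ᵢ eᵢ ∧ ι_{eⁱ}` acts on degree `q` as multiplication by `q`. -/
theorem sum_ι_mul_contr {κ : Type*} [Fintype κ] (b : Module.Basis κ ℝ M) {q : ℕ}
    {x : ExteriorAlgebra ℝ M} (hx : x ∈ ⋀[ℝ]^q M) :
    ∑ i, ι ℝ (b i) * contr (b.coord i) x = (q : ℝ) • x := by
  induction hx using Submodule.pow_induction_on_left' with
  | algebraMap r => simp [contr_algebraMap]
  | add x y i hx hy h1 h2 => simp only [map_add, mul_add, Finset.sum_add_distrib, h1, h2, smul_add]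
  | mem_mul a ha i x hx ih =>
    obtain ⟨a, rfl⟩ := ha
    have : ∀ k, ι ℝ (b k) * contr (b.coord k) (ι ℝ a * x)
        = ι ℝ (b.repr a k • b k) * x + ι ℝ a * (ι ℝ (b k) * contr (b.coord k) x) := by
      intro k
      rw [contr_ι_mul, mul_sub, ι_mul_left_comm a (b k)]
      simp [sub_eq_add_neg]
    simp only [this]
    rw [Finset.sum_add_distrib, ← Finset.sum_mul, ← map_sum, b.sum_repr, ← Finset.mul_sum, ih]
    rw [mul_smul_comm, Nat.cast_succ]
    module

theorem eq_zero_of_forall_ι_mul_eq_zero [Module.Finite ℝ M] {q : ℕ}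
    (hq : q < Module.finrank ℝ M) {x : ExteriorAlgebra ℝ M} (hx : x ∈ ⋀[ℝ]^q M)
    (h : ∀ m : M, ι ℝ m * x = 0) : x = 0 := by
  have b := Module.finBasis ℝ M
  have key : ∀ i, ι ℝ (b i) * contr (b.coord i) x = x := by
    intro i
    have := contr_ι_mul (b.coord i) (b i) x
    rw [h, map_zero] at this
    simpa using (sub_eq_zero.mp this.symm).symm
  have h2 := sum_ι_mul_contr b hx
  simp only [key, Finset.sum_const, Finset.card_univ, Fintype.card_fin] at h2
  rw [← Nat.cast_smul_eq_nsmul ℝ, ← sub_eq_zero, ← sub_smul] at h2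
  refine (smul_eq_zero.mp h2).resolve_left (sub_ne_zero.mpr ?_)
  exact_mod_cast hq.ne'

/-- The wedge pairing between complementary degrees is nondegenerate. -/
theorem eq_zero_of_forall_mul_eq_zero [Module.Finite ℝ M] {k l : ℕ}
    (hkl : k + l = Module.finrank ℝ M) {x : ExteriorAlgebra ℝ M} (hx : x ∈ ⋀[ℝ]^l M)
    (h : ∀ y ∈ ⋀[ℝ]^k M, y * x = 0) : x = 0 := by
  induction k generalizing l x with
  | zero =>
    rw [← one_mul x]
    exact h 1 (by rw [exteriorPower, pow_zero]; exact Submodule.one_le.mp le_rfl)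
  | succ k ih =>
    refine eq_zero_of_forall_ι_mul_eq_zero (by omega) hx fun m => ?_
    refine ih (l := l + 1) (by omega) (ι_mul_mem m hx) fun y hy => ?_
    rw [← mul_assoc, mul_ι_of_mem hy, smul_mul_assoc, h _ (ι_mul_mem m hy), smul_zero]

theorem eq_zero_of_finrank_lt [Module.Finite ℝ M] {q : ℕ} (hq : Module.finrank ℝ M < q)
    {x : ExteriorAlgebra ℝ M} (hx : x ∈ ⋀[ℝ]^q M) : x = 0 := by
  have h := exteriorPower.finrank_eq (R := ℝ) (M := M) q
  rw [Nat.choose_eq_zero_of_lt hq] at h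
  have := Module.finrank_zero_iff.mp h
  exact congrArg Subtype.val (Subsingleton.elim (⟨x, hx⟩ : ⋀[ℝ]^q M) 0)

end ExteriorContraction

section NullSplitting

open ExteriorAlgebra

variable {M : Type*} [AddCommGroup M] [Module ℝ M]

theorem neg_one_pow_mul_cancel (k : ℕ) (r : ℝ) : (-1) ^ k * ((-1) ^ k * r) = r := by
  rw [← mul_assoc, ← mul_pow]
  simp

/-- Functionals `d, d'` and vectors `e, f` spanning a hyperbolic plane and its dual, where `d`
corresponds to the null vector `e` and `d'` to the null vector `f`. -/
structure IsNullPair (d d' : Module.Dual ℝ M) (e f : M) : Prop where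
  left_left : d e = 0
  left_right : d f = 1
  right_left : d' e = 1
  right_right : d' f = 0

/-- Elements killed by contraction with both functionals. -/
def IsHorizontal (d d' : Module.Dual ℝ M) (x : ExteriorAlgebra ℝ M) : Prop :=
  contr d x = 0 ∧ contr d' x = 0

namespace IsNullPair

variable {d d' : Module.Dual ℝ M} {e f : M}

theorem isHorizontal_iff (h : IsNullPair d d' e f) {x : ExteriorAlgebra ℝ M} :
    IsHorizontal d d' x
      ↔ ExteriorAlgebra.map (projKer d' e ∘ₗ projKer d f) x = x := by
  constructor
  · rintro ⟨h1, h2⟩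
    rw [← map_comp_map, AlgHom.comp_apply, map_projKer d f, h1, mul_zero, sub_zero, map_projKer,
      h2, mul_zero, sub_zero]
  · intro hx
    rw [← hx]
    refine ⟨contr_map_eq_zero _ _ (fun m => ?_) x, contr_map_eq_zero _ _ (fun m => ?_) x⟩ <;>
    simp [projKer, h.left_left, h.left_right, h.right_left, h.right_right]

theorem isHorizontal_mul (h : IsNullPair d d' e f) {x y : ExteriorAlgebra ℝ M}
    (hx : IsHorizontal d d' x) (hy : IsHorizontal d d' y) : IsHorizontal d d' (x * y) := by
  rw [h.isHorizontal_iff] at *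
  rw [map_mul, hx, hy]

theorem eq_zero_of_isHorizontal [Module.Finite ℝ M] (h : IsNullPair d d' e f) {q : ℕ}
    (hq : Module.finrank ℝ M < q + 2) {x : ExteriorAlgebra ℝ M} (hx : x ∈ ⋀[ℝ]^q M)
    (hx' : IsHorizontal d d' x) : x = 0 := by
  have h0 := eq_zero_of_finrank_lt (q := q + 2) (by omega) (ι_mul_mem e (ι_mul_mem f hx))
  have h1 := congrArg (fun z => contr d (contr d' z)) h0
  simpa [contr_ι_mul, h.left_left, h.left_right, h.right_left, h.right_right, hx'.1, hx'.2] using h1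

/-- Splitting of a homogeneous element into its four components, as an induction principle. -/
@[elab_as_elim]
theorem induction_on (h : IsNullPair d d' e f) {m : ℕ} {C : ExteriorAlgebra ℝ M → Prop}
    (add : ∀ x y, C x → C y → C (x + y))
    (horizontal : ∀ x ∈ ⋀[ℝ]^m M, IsHorizontal d d' x → C x)
    (left : ∀ k, k + 1 = m → ∀ x ∈ ⋀[ℝ]^k M, IsHorizontal d d' x → C (ι ℝ e * x))
    (right : ∀ k, k + 1 = m → ∀ x ∈ ⋀[ℝ]^k M, IsHorizontal d d' x → C (ι ℝ f * x))
    (both : ∀ k, k + 2 = m → ∀ x ∈ ⋀[ℝ]^k M, IsHorizontal d d' x →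
      C (ι ℝ e * (ι ℝ f * x)))
    {x : ExteriorAlgebra ℝ M} (hx : x ∈ ⋀[ℝ]^m M) : C x := by
  have half : ∀ {k : ℕ} {y : ExteriorAlgebra ℝ M}, y ∈ ⋀[ℝ]^k M → contr d' y = 0 →
      ∃ a ∈ ⋀[ℝ]^k M, IsHorizontal d d' a ∧
        ((k = 0 ∧ y = a) ∨
          ∃ l, l + 1 = k ∧ ∃ b ∈ ⋀[ℝ]^l M, IsHorizontal d d' b ∧ y = a + ι ℝ f * b) := by
    intro k y hy hy'
    rcases k with _ | k
    · exact ⟨y, hy, ⟨contr_eq_zero_of_mem_zero d hy, hy'⟩, Or.inl ⟨rfl, rfl⟩⟩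
    · have hb := contr_mem d hy
      have hb1 : contr d (contr d y) = 0 := CliffordAlgebra.contractLeft_contractLeft (Q := 0) d y
      have hb2 : contr d' (contr d y) = 0 := by
        have : contr d' (contr d y) = -contr d (contr d' y) :=
          CliffordAlgebra.contractLeft_comm (Q := 0) d' d y
        rw [this, hy', map_zero, neg_zero]
      refine ⟨y - ι ℝ f * contr d y, Submodule.sub_mem _ hy (ι_mul_mem f hb), ⟨?_, ?_⟩,
        Or.inr ⟨k, rfl, contr d y, hb, ⟨hb1, hb2⟩, by abel⟩⟩
      · simp [contr_ι_mul, h.left_right, hb1]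
      · simp [contr_ι_mul, h.right_right, hb2, hy']
  have first : ∀ {y : ExteriorAlgebra ℝ M}, y ∈ ⋀[ℝ]^m M → contr d' y = 0 → C y := by
    intro y hy hy'
    obtain ⟨a, ha, ha', ⟨-, rfl⟩ | ⟨l, hl, b, hb, hb', rfl⟩⟩ := half hy hy'
    · exact horizontal _ ha ha'
    · exact add _ _ (horizontal a ha ha') (right l hl b hb hb')
  rcases m with _ | m
  · exact first hx (contr_eq_zero_of_mem_zero d' hx)
  · have hz := contr_mem d' hx
    have hz' : contr d' (contr d' x) = 0 := CliffordAlgebra.contractLeft_contractLeft (Q := 0) d' x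
    have hsplit : x = (x - ι ℝ e * contr d' x) + ι ℝ e * contr d' x := by abel
    rw [hsplit]
    refine add _ _ (first (Submodule.sub_mem _ hx (ι_mul_mem e hz)) ?_) ?_
    · simp [contr_ι_mul, h.right_left, hz']
    · obtain ⟨a, ha, ha', ⟨-, h0⟩ | ⟨l, hl, b, hb, hb', h0⟩⟩ := half hz hz'
      · rw [h0]
        exact left m rfl a ha ha'
      · rw [h0, mul_add]
        exact add _ _ (left m rfl a ha ha') (both l (by omega) b hb hb')

end IsNullPair

/-- A family of symmetric pairings on the exterior powers for which the wedge product with `e`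
(resp. `f`) is adjoint to the contraction with `d` (resp. `d'`). -/
structure IsAdjointPairing (B : ℕ → ExteriorAlgebra ℝ M →ₗ[ℝ] ExteriorAlgebra ℝ M →ₗ[ℝ] ℝ)
    (d d' : Module.Dual ℝ M) (e f : M) : Prop where
  symm : ∀ q, ∀ a ∈ ⋀[ℝ]^q M, ∀ b ∈ ⋀[ℝ]^q M, B q a b = B q b a
  left : ∀ q, ∀ a ∈ ⋀[ℝ]^q M, ∀ b ∈ ⋀[ℝ]^(q + 1) M,
    B (q + 1) (ι ℝ e * a) b = B q a (contr d b)
  right : ∀ q, ∀ a ∈ ⋀[ℝ]^q M, ∀ b ∈ ⋀[ℝ]^(q + 1) M,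
    B (q + 1) (ι ℝ f * a) b = B q a (contr d' b)

namespace IsAdjointPairing

variable {B : ℕ → ExteriorAlgebra ℝ M →ₗ[ℝ] ExteriorAlgebra ℝ M →ₗ[ℝ] ℝ}
  {d d' : Module.Dual ℝ M} {e f : M} {n q : ℕ} {b c μ : ExteriorAlgebra ℝ M}

theorem mul_star_horizontal (hB : IsAdjointPairing B d d' e f)
    (hb : b ∈ ⋀[ℝ]^q M) (hb' : IsHorizontal d d' b)
    (hbc : ∀ a ∈ ⋀[ℝ]^q M, IsHorizontal d d' a → a * c = B q a b • μ)
    (h : IsNullPair d d' e f) {a : ExteriorAlgebra ℝ M} (ha : a ∈ ⋀[ℝ]^q M) :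
    a * (ι ℝ e * (ι ℝ f * -c)) = B q a b • -(ι ℝ e * (ι ℝ f * μ)) := by
  refine h.induction_on ?_ ?_ ?_ ?_ ?_ ha
  · intro x y hx hy
    rw [add_mul, hx, hy, map_add, LinearMap.add_apply, add_smul]
  · intro x hx hx'
    rw [← mul_assoc, mul_ι_of_mem hx, smul_mul_assoc, mul_assoc, ← mul_assoc x, mul_ι_of_mem hx]
    simp only [mul_neg, smul_mul_assoc, mul_assoc, hbc x hx hx', mul_smul_comm, smul_neg, smul_smul,
      neg_one_pow_mul_cancel]
  · intro k hk x hx hx'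
    subst hk
    rw [hB.left _ _ hx _ hb, hb'.1, mul_assoc, ← mul_assoc x, mul_ι_of_mem hx]
    simp [mul_assoc, ι_mul_ι_mul_self]
  · intro k hk x hx hx'
    subst hk
    rw [hB.right _ _ hx _ hb, hb'.2, ι_mul_left_comm e f, mul_assoc, ← mul_neg, ← mul_assoc x,
      mul_ι_of_mem hx]
    simp [mul_assoc, ι_mul_ι_mul_self]
  · intro k hk x hx hx'
    subst hk
    rw [hB.left _ _ (ι_mul_mem f hx) _ hb, hb'.1, mul_assoc, ← mul_assoc _ (ι ℝ e),
      mul_ι_of_mem (ι_mul_mem f hx)]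
    simp [mul_assoc, ι_mul_ι_mul_self]

theorem mul_star_left [Module.Finite ℝ M] (hB : IsAdjointPairing B d d' e f)
    (hn : Module.finrank ℝ M = n + 2) (hqn : q ≤ n)
    (hb : b ∈ ⋀[ℝ]^q M) (hb' : IsHorizontal d d' b)
    (hc : c ∈ ⋀[ℝ]^(n - q) M) (hc' : IsHorizontal d d' c)
    (hbc : ∀ a ∈ ⋀[ℝ]^q M, IsHorizontal d d' a → a * c = B q a b • μ)
    (h : IsNullPair d d' e f) {a : ExteriorAlgebra ℝ M} (ha : a ∈ ⋀[ℝ]^(q + 1) M) :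
    a * (ι ℝ e * ((-1 : ℝ) ^ q • c)) = B (q + 1) a (ι ℝ e * b) • -(ι ℝ e * (ι ℝ f * μ)) := by
  have hd : contr d (ι ℝ e * b) = 0 := by simp [contr_ι_mul, h.left_left, hb'.1]
  have hd' : contr d' (ι ℝ e * b) = b := by simp [contr_ι_mul, h.right_left, hb'.2]
  have heb := ι_mul_mem e hb
  refine h.induction_on ?_ ?_ ?_ ?_ ?_ ha
  · intro x y hx hy
    rw [add_mul, hx, hy, map_add, LinearMap.add_apply, add_smul]
  · intro x hx hx'
    rw [hB.symm _ _ hx _ heb, hB.left _ _ hb _ hx, hx'.1, ← mul_assoc, mul_ι_of_mem hx,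
      smul_mul_assoc, mul_assoc, mul_smul_comm,
      h.eq_zero_of_isHorizontal (by omega) (mul_mem hx hc) (h.isHorizontal_mul hx' hc')]
    simp
  · intro k hk x hx hx'
    obtain rfl : k = q := by omega
    rw [hB.left _ _ hx _ heb, hd, mul_assoc, ← mul_assoc x, mul_ι_of_mem hx]
    simp [mul_assoc, ι_mul_ι_mul_self]
  · intro k hk x hx hx'
    obtain rfl : k = q := by omega
    rw [hB.right _ _ hx _ heb, hd', mul_assoc, ← mul_assoc x, mul_ι_of_mem hx]
    simp only [smul_mul_assoc, mul_smul_comm, smul_smul, mul_assoc, hbc x hx hx',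
      neg_one_pow_mul_cancel]
    rw [ι_mul_left_comm f e]
  · intro k hk x hx hx'
    obtain rfl : k + 1 = q := by omega
    rw [hB.left _ _ (ι_mul_mem f hx) _ heb, hd, mul_assoc, ← mul_assoc _ (ι ℝ e),
      mul_ι_of_mem (ι_mul_mem f hx)]
    simp [mul_assoc, ι_mul_ι_mul_self]

theorem mul_star_right [Module.Finite ℝ M] (hB : IsAdjointPairing B d d' e f)
    (hn : Module.finrank ℝ M = n + 2) (hqn : q ≤ n)
    (hb : b ∈ ⋀[ℝ]^q M) (hb' : IsHorizontal d d' b)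
    (hc : c ∈ ⋀[ℝ]^(n - q) M) (hc' : IsHorizontal d d' c)
    (hbc : ∀ a ∈ ⋀[ℝ]^q M, IsHorizontal d d' a → a * c = B q a b • μ)
    (h : IsNullPair d d' e f) {a : ExteriorAlgebra ℝ M} (ha : a ∈ ⋀[ℝ]^(q + 1) M) :
    a * (ι ℝ f * ((-1 : ℝ) ^ (q + 1) • c))
      = B (q + 1) a (ι ℝ f * b) • -(ι ℝ e * (ι ℝ f * μ)) := by
  have hB' : IsAdjointPairing B d' d f e := ⟨hB.symm, hB.right, hB.left⟩
  have h' : IsNullPair d' d f e := ⟨h.right_right, h.right_left, h.left_right, h.left_left⟩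
  have := hB'.mul_star_left hn hqn hb hb'.symm hc hc'.symm
    (fun a ha ha' => hbc a ha ha'.symm) h' ha
  rw [pow_succ, mul_neg_one, neg_smul, mul_neg, mul_neg, this, ι_mul_left_comm e f,
    smul_neg, smul_neg, smul_neg]

theorem mul_star_both [Module.Finite ℝ M] (hB : IsAdjointPairing B d d' e f)
    (hn : Module.finrank ℝ M = n + 2) (hqn : q ≤ n)
    (hb : b ∈ ⋀[ℝ]^q M) (hb' : IsHorizontal d d' b)
    (hc : c ∈ ⋀[ℝ]^(n - q) M) (hc' : IsHorizontal d d' c)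
    (hbc : ∀ a ∈ ⋀[ℝ]^q M, IsHorizontal d d' a → a * c = B q a b • μ)
    (h : IsNullPair d d' e f) {a : ExteriorAlgebra ℝ M} (ha : a ∈ ⋀[ℝ]^(q + 2) M) :
    a * c = B (q + 2) a (ι ℝ e * (ι ℝ f * b)) • -(ι ℝ e * (ι ℝ f * μ)) := by
  have hfb := ι_mul_mem f hb
  have hefb := ι_mul_mem e hfb
  have hd : contr d (ι ℝ e * (ι ℝ f * b)) = -(ι ℝ e * b) := by
    simp [contr_ι_mul, h.left_left, h.left_right, hb'.1]
  have hd' : contr d' (ι ℝ e * (ι ℝ f * b)) = ι ℝ f * b := by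
    simp [contr_ι_mul, h.right_left, h.right_right, hb'.2]
  refine h.induction_on ?_ ?_ ?_ ?_ ?_ ha
  · intro x y hx hy
    rw [add_mul, hx, hy, map_add, LinearMap.add_apply, add_smul]
  · intro x hx hx'
    rw [hB.symm _ _ hx _ hefb, hB.left _ _ hfb _ hx, hx'.1,
      h.eq_zero_of_isHorizontal (by omega) (mul_mem hx hc) (h.isHorizontal_mul hx' hc')]
    simp
  · intro k hk x hx hx'
    obtain rfl : k = q + 1 := by omega
    rw [hB.left _ _ hx _ hefb, hd, map_neg, hB.symm _ _ hx _ (ι_mul_mem e hb),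
      hB.left _ _ hb _ hx, hx'.1, mul_assoc,
      h.eq_zero_of_isHorizontal (by omega) (mul_mem hx hc) (h.isHorizontal_mul hx' hc')]
    simp
  · intro k hk x hx hx'
    obtain rfl : k = q + 1 := by omega
    rw [hB.right _ _ hx _ hefb, hd', hB.symm _ _ hx _ hfb, hB.right _ _ hb _ hx, hx'.2, mul_assoc,
      h.eq_zero_of_isHorizontal (by omega) (mul_mem hx hc) (h.isHorizontal_mul hx' hc')]
    simp
  · intro k hk x hx hx'
    obtain rfl : k = q := by omega
    rw [hB.left _ _ (ι_mul_mem f hx) _ hefb, hd, map_neg,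
      hB.right _ _ hx _ (ι_mul_mem e hb)]
    simp [contr_ι_mul, h.right_left, hb'.2, mul_assoc, hbc x hx hx']

end IsAdjointPairing

end NullSplitting

section FlatForms

open ExteriorAlgebra

variable {W : Type*} [AddCommGroup W] [Module ℝ W]
  {g : LinearMap.BilinForm ℝ W}

theorem span_range_flatMulti [FiniteDimensional ℝ W] (hnd : g.Nondegenerate) (q : ℕ) :
    Submodule.span ℝ (Set.range (flatMulti g q)) = ⋀[ℝ]^q (Module.Dual ℝ W) := by
  rw [← ιMulti_span_fixedDegree]
  congr 1
  ext z
  constructor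
  · rintro ⟨x, rfl⟩
    exact ⟨_, rfl⟩
  · rintro ⟨f, rfl⟩
    refine ⟨fun i => (g.toDual hnd).symm (f i), ?_⟩
    have : (fun i => flat g ((g.toDual hnd).symm (f i))) = f := by
      funext i
      exact (g.toDual hnd).apply_symm_apply (f i)
    rw [flatMulti, this]

theorem flatWedge_flatMulti (v : W) {q : ℕ} (x : Fin q → W) :
    flatWedge g v (flatMulti g q x) = flatMulti g (q + 1) (Fin.cons v x : Fin (q + 1) → W) := by
  rw [flatMulti, flatMulti, ιMulti_succ_apply]
  rfl

theorem iprod_flatMulti (v : W) {q : ℕ} (x : Fin (q + 1) → W) :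
    iprod v (flatMulti g (q + 1) x)
      = ∑ j : Fin (q + 1), ((-1 : ℝ) ^ (j : ℕ) * g (x j) v) • flatMulti g q (x ∘ j.succAbove) :=
  contr_ιMulti (Module.Dual.eval ℝ W v) fun i => flat g (x i)

variable {B : ℕ → FormAlg W →ₗ[ℝ] FormAlg W →ₗ[ℝ] ℝ}

theorem gram_symm [FiniteDimensional ℝ W] (hsymm : g.IsSymm) (hnd : g.Nondegenerate)
    (hB : ∀ (q : ℕ) (x y : Fin q → W),
      B q (flatMulti g q x) (flatMulti g q y) = Matrix.det (Matrix.of fun i j => g (x i) (y j)))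
    (q : ℕ) (a : FormAlg W) (ha : a ∈ ⋀[ℝ]^q (Module.Dual ℝ W)) (b : FormAlg W)
    (hb : b ∈ ⋀[ℝ]^q (Module.Dual ℝ W)) : B q a b = B q b a := by
  rw [← span_range_flatMulti hnd] at ha hb
  induction ha, hb using Submodule.span_induction₂ with
  | mem_mem a b ha hb =>
    obtain ⟨x, rfl⟩ := ha
    obtain ⟨y, rfl⟩ := hb
    rw [hB, hB, ← Matrix.det_transpose]
    congr 1
    ext i j
    exact hsymm.eq _ _
  | zero_left => simp
  | zero_right => simp
  | add_left _ _ _ _ _ _ h1 h2 => simp [h1, h2]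
  | add_right _ _ _ _ _ _ h1 h2 => simp [h1, h2]
  | smul_left _ _ _ _ _ h1 => simp [h1]
  | smul_right _ _ _ _ _ h1 => simp [h1]

/-- Wedging with `v♭` is adjoint to contraction with `v`, by Laplace expansion of the Gram
determinant. -/
theorem gram_flatWedge [FiniteDimensional ℝ W] (hsymm : g.IsSymm) (hnd : g.Nondegenerate)
    (hB : ∀ (q : ℕ) (x y : Fin q → W),
      B q (flatMulti g q x) (flatMulti g q y) = Matrix.det (Matrix.of fun i j => g (x i) (y j)))
    (v : W) (q : ℕ) (a : FormAlg W) (ha : a ∈ ⋀[ℝ]^q (Module.Dual ℝ W)) (b : FormAlg W)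
    (hb : b ∈ ⋀[ℝ]^(q + 1) (Module.Dual ℝ W)) :
    B (q + 1) (ι ℝ (g v) * a) b = B q a (contr (Module.Dual.eval ℝ W v) b) := by
  rw [← span_range_flatMulti hnd] at ha hb
  induction ha, hb using Submodule.span_induction₂ with
  | mem_mem a b ha hb =>
    obtain ⟨x, rfl⟩ := ha
    obtain ⟨y, rfl⟩ := hb
    change B (q + 1) (flatWedge g v (flatMulti g q x)) _
      = B q _ (iprod v (flatMulti g (q + 1) y))
    rw [flatWedge_flatMulti, iprod_flatMulti, hB, Matrix.det_succ_row_zero, map_sum]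
    refine Finset.sum_congr rfl fun j _ => ?_
    rw [map_smul, hB, smul_eq_mul, ← hsymm.eq v (y j)]
    rfl
  | zero_left => simp
  | zero_right => simp
  | add_left _ _ _ _ _ _ h1 h2 => simp [mul_add, h1, h2]
  | add_right _ _ _ _ _ _ h1 h2 => simp [h1, h2]
  | smul_left _ _ _ _ _ h1 => simp [h1]
  | smul_right _ _ _ _ _ h1 => simp [h1]

end FlatForms

/-- Components of the Hodge dual of a split `(p+1)`-form.  Let `V` have dimension `n+2`,
with a null pair `(e₋,e₊)`, `⟨e₋,e₊⟩ = 1`, and let `w` be an orthonormal basis of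
`W = (span{e₋,e₊})^⊥` (signature `(r,s)`), with `dM = w₁♭∧⋯∧w_n♭` the volume form of `W`
and `dM' = -e₋♭∧e₊♭∧dM` the volume form of `V`.  Let `H'` be the Hodge star of `V`
(w.r.t. `dM'`) and `HW` the Hodge star of `W` (w.r.t. `dM`), both characterised by
`α ∧ ⋆β = ⟨α,β⟩·vol`, and let `α` be a `(p+1)`-form with components
`(α₋, α₀, α∓, α₊)`.  Then `H' α` has components
`((-1)^p ⋆α₋, ⋆α∓, -⋆α₀, (-1)^{p+1} ⋆α₊)`. -/
theorem stmt_9 [FiniteDimensional ℝ V]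
    (n r s : ℕ) (hrs : r + s = n) (hdim : Module.finrank ℝ V = n + 2)
    (g : LinearMap.BilinForm ℝ V) (hsymm : g.IsSymm) (hnd : g.Nondegenerate)
    (em ep : V) (hem : g em em = 0) (hep : g ep ep = 0) (hpair : g em ep = 1)
    (w : Fin n → V)
    (hw : ∀ i j : Fin n,
      g (w i) (w j) = if i = j then (if (i : ℕ) < r then -1 else 1) else 0)
    (hwm : ∀ i, g em (w i) = 0) (hwp : ∀ i, g ep (w i) = 0)
    (Bq : ℕ → FormAlg V →ₗ[ℝ] FormAlg V →ₗ[ℝ] ℝ)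
    (hBq : ∀ (q : ℕ) (x y : Fin q → V),
      Bq q (flatMulti g q x) (flatMulti g q y)
        = Matrix.det (Matrix.of fun i j => g (x i) (y j)))
    -- the Hodge star `H'` of `V`, w.r.t. the volume form `dM' = -e₋♭∧e₊♭∧dM`
    (H' : FormAlg V →ₗ[ℝ] FormAlg V)
    (hH'deg : ∀ q : ℕ, ∀ α ∈ ⋀[ℝ]^q (Module.Dual ℝ V),
      H' α ∈ ⋀[ℝ]^(n + 2 - q) (Module.Dual ℝ V))
    (hH'def : ∀ q : ℕ, ∀ α ∈ ⋀[ℝ]^q (Module.Dual ℝ V), ∀ β ∈ ⋀[ℝ]^q (Module.Dual ℝ V),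
      wedgeF α (H' β)
        = Bq q α β • (-(flatWedge g em (flatWedge g ep (flatMulti g n w)))))
    -- the Hodge star `HW` of `W`, acting on forms on `W`, w.r.t. the volume form `dM`
    (HW : FormAlg V →ₗ[ℝ] FormAlg V)
    (hHWdeg : ∀ q : ℕ, ∀ α ∈ ⋀[ℝ]^q (Module.Dual ℝ V),
      iprod em α = 0 → iprod ep α = 0 →
      (HW α ∈ ⋀[ℝ]^(n - q) (Module.Dual ℝ V) ∧ iprod em (HW α) = 0 ∧ iprod ep (HW α) = 0))
    (hHWdef : ∀ q : ℕ, ∀ α ∈ ⋀[ℝ]^q (Module.Dual ℝ V), ∀ β ∈ ⋀[ℝ]^q (Module.Dual ℝ V),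
      iprod em α = 0 → iprod ep α = 0 → iprod em β = 0 → iprod ep β = 0 →
      wedgeF α (HW β) = Bq q α β • flatMulti g n w)
    -- a `(p+1)`-form `α` with components `(α₋, α₀, α∓, α₊)`
    (p : ℕ) (α αm α0 αmp αp : FormAlg V)
    (hαm : αm ∈ ⋀[ℝ]^p (Module.Dual ℝ V)) (hαm' : iprod em αm = 0) (hαm'' : iprod ep αm = 0)
    (hα0 : α0 ∈ ⋀[ℝ]^(p + 1) (Module.Dual ℝ V)) (hα0' : iprod em α0 = 0)
    (hα0'' : iprod ep α0 = 0)
    (hαmp : αmp ∈ ⋀[ℝ]^(p - 1) (Module.Dual ℝ V)) (hαmp' : iprod em αmp = 0)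
    (hαmp'' : iprod ep αmp = 0)
    (hαp : αp ∈ ⋀[ℝ]^p (Module.Dual ℝ V)) (hαp' : iprod em αp = 0) (hαp'' : iprod ep αp = 0)
    (hdec : α = flatWedge g em αm + α0 + flatWedge g em (flatWedge g ep αmp)
        + flatWedge g ep αp) :
    H' α = flatWedge g em (((-1 : ℝ)) ^ p • HW αm) + HW αmp
        + flatWedge g em (flatWedge g ep (-(HW α0)))
        + flatWedge g ep (((-1 : ℝ)) ^ (p + 1) • HW αp) := by
  have hpair' : g ep em = 1 := by rw [← hpair]; exact hsymm.eq _ _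
  have hnull : IsNullPair (Module.Dual.eval ℝ V em) (Module.Dual.eval ℝ V ep) (g em) (g ep) :=
    ⟨hem, hpair', hpair, hep⟩
  have hadj : IsAdjointPairing Bq (Module.Dual.eval ℝ V em) (Module.Dual.eval ℝ V ep)
      (g em) (g ep) :=
    ⟨gram_symm hsymm hnd hBq, gram_flatWedge hsymm hnd hBq em, gram_flatWedge hsymm hnd hBq ep⟩
  have hdim' : Module.finrank ℝ (Module.Dual ℝ V) = n + 2 := by
    rw [Subspace.dual_finrank_eq, hdim]
  have unique : ∀ {m l : ℕ} {β γ : FormAlg V}, m + l = n + 2 → β ∈ ⋀[ℝ]^m (Module.Dual ℝ V) →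
      γ ∈ ⋀[ℝ]^l (Module.Dual ℝ V) →
      (∀ a ∈ ⋀[ℝ]^m (Module.Dual ℝ V), a * γ = Bq m a β •
        -(ExteriorAlgebra.ι ℝ (g em) * (ExteriorAlgebra.ι ℝ (g ep) * flatMulti g n w))) →
      H' β = γ := by
    intro m l β γ hml hβ hγ h
    have hd := hH'deg m β hβ
    rw [show n + 2 - m = l by omega] at hd
    refine sub_eq_zero.mp (eq_zero_of_forall_mul_eq_zero (k := m) (l := l) (by omega)
      (Submodule.sub_mem _ hd hγ) fun a ha => ?_)
    rw [mul_sub, h a ha]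
    exact sub_eq_zero.mpr (hH'def m a ha β hβ)
  have horizontal : ∀ {q : ℕ} {b : FormAlg V}, b ∈ ⋀[ℝ]^q (Module.Dual ℝ V) →
      iprod em b = 0 → iprod ep b = 0 → q ≤ n ∨ b = 0 := by
    intro q b hb h1 h2
    refine (le_or_gt q n).imp_right fun hq => ?_
    exact hnull.eq_zero_of_isHorizontal (by omega) hb ⟨h1, h2⟩
  have hL : H' (flatWedge g em αm) = flatWedge g em ((-1 : ℝ) ^ p • HW αm) := by
    rcases horizontal hαm hαm' hαm'' with hq | rfl
    · obtain ⟨hc, hc'⟩ := hHWdeg p αm hαm hαm' hαm''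
      exact unique (m := p + 1) (l := n - p + 1) (by omega) (ExteriorAlgebra.ι_mul_mem _ hαm)
        (ExteriorAlgebra.ι_mul_mem _ (Submodule.smul_mem _ _ hc)) fun a ha =>
        hadj.mul_star_left hdim' hq hαm ⟨hαm', hαm''⟩ hc hc'
          (fun a ha ha' => hHWdef p a ha αm hαm ha'.1 ha'.2 hαm' hαm'') hnull ha
    · simp [flatWedge, cwedge]
  have hR : H' (flatWedge g ep αp) = flatWedge g ep ((-1 : ℝ) ^ (p + 1) • HW αp) := by
    rcases horizontal hαp hαp' hαp'' with hq | rfl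
    · obtain ⟨hc, hc'⟩ := hHWdeg p αp hαp hαp' hαp''
      exact unique (m := p + 1) (l := n - p + 1) (by omega) (ExteriorAlgebra.ι_mul_mem _ hαp)
        (ExteriorAlgebra.ι_mul_mem _ (Submodule.smul_mem _ _ hc)) fun a ha =>
        hadj.mul_star_right hdim' hq hαp ⟨hαp', hαp''⟩ hc hc'
          (fun a ha ha' => hHWdef p a ha αp hαp ha'.1 ha'.2 hαp' hαp'') hnull ha
    · simp [flatWedge, cwedge]
  have hH : H' α0 = flatWedge g em (flatWedge g ep (-(HW α0))) := by
    rcases horizontal hα0 hα0' hα0'' with hq | rfl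
    · obtain ⟨hc, -⟩ := hHWdeg (p + 1) α0 hα0 hα0' hα0''
      exact unique (l := n - (p + 1) + 1 + 1) (by omega) hα0
        (ExteriorAlgebra.ι_mul_mem _ (ExteriorAlgebra.ι_mul_mem _ (Submodule.neg_mem _ hc)))
        fun a ha => hadj.mul_star_horizontal hα0 ⟨hα0', hα0''⟩
          (fun a ha ha' => hHWdef (p + 1) a ha α0 hα0 ha'.1 ha'.2 hα0' hα0'') hnull ha
    · simp [flatWedge, cwedge]
  have hLR : H' (flatWedge g em (flatWedge g ep αmp)) = HW αmp := by
    rcases horizontal hαmp hαmp' hαmp'' with hq | rfl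
    · obtain ⟨hc, hc'⟩ := hHWdeg (p - 1) αmp hαmp hαmp' hαmp''
      exact unique (m := p - 1 + 2) (by omega)
        (ExteriorAlgebra.ι_mul_mem _ (ExteriorAlgebra.ι_mul_mem _ hαmp)) hc fun a ha =>
        hadj.mul_star_both hdim' hq hαmp ⟨hαmp', hαmp''⟩ hc hc'
          (fun a ha ha' => hHWdef (p - 1) a ha αmp hαmp ha'.1 ha'.2 hαmp' hαmp'') hnull ha
    · simp [flatWedge, cwedge]
  rw [hdec, map_add, map_add, map_add, hL, hH, hLR, hR]
  abel
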